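/- Let n ≥ 2, 1 < p, p̃₁, p̃₂ < ∞, α₁ < n(p−1), n + α₂ > 0, 0 < β ≤ α₁/(p−1), and suppose (α₂+n)/q = (α₁+n)/p − β. Then the fractional Hardy operator H_β maps the weighted mixed radial-angular space L^p_{rad}L^{p̃₁}_{ang}(ℝⁿ, r^{α₁}) to the weak space 𝓦L^q_{rad}L^{p̃₂}_{ang}(ℝⁿ, r^{α₂}) with operator norm exactly ω_n^{1/p̃₁' + 1/p̃₂} ν_n^{β/n − 1} (1/(n − α₁/(p−1)))^{1/p'} (1/(n+α₂))^{1/q}. -/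

import Mathlib

open MeasureTheory Set ENNReal Metric

/-- The surface measure on the unit sphere `S^{n-1}` in `ℝⁿ`. -/
noncomputable def sphereMeasure (n : ℕ) :
    Measure (sphere (0 : EuclideanSpace ℝ (Fin n)) 1) :=
  (volume : Measure (EuclideanSpace ℝ (Fin n))).toSphere

/-- The weighted mixed radial-angular norm
`‖f‖_{L^p_{rad}L^{pt}_{ang}(ℝⁿ, r^α)} = (∫₀^∞ ‖f(r·)‖_{L^{pt}(S^{n-1})}^p r^{n-1+α} dr)^{1/p}`. -/
noncomputable def mixedNormW (n : ℕ) (p pt α : ℝ)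
    (f : EuclideanSpace ℝ (Fin n) → ℝ) : ℝ≥0∞ :=
  (∫⁻ r in Ioi (0 : ℝ),
    (∫⁻ θ : sphere (0 : EuclideanSpace ℝ (Fin n)) 1,
        ENNReal.ofReal |f (r • (θ : EuclideanSpace ℝ (Fin n)))| ^ pt
      ∂(sphereMeasure n)) ^ (p / pt) *
      ENNReal.ofReal (r ^ ((n : ℝ) - 1 + α))) ^ (1 / p)

/-- The weak weighted mixed radial-angular quasinorm
`sup_{λ>0} λ ‖𝟙_{|g|>λ}‖_{L^p_{rad}L^{pt}_{ang}(ℝⁿ, r^α)}`. -/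
noncomputable def weakMixedNormW (n : ℕ) (p pt α : ℝ)
    (g : EuclideanSpace ℝ (Fin n) → ℝ) : ℝ≥0∞ :=
  ⨆ (lam : ℝ) (_ : 0 < lam),
    ENNReal.ofReal lam * mixedNormW n p pt α (fun x => if lam < |g x| then 1 else 0)

/-- The fractional Hardy operator `H_β f(x) = |B(0,|x|)|^{β/n - 1} ∫_{|y|≤|x|} f(y) dy`. -/
noncomputable def fracHardy (n : ℕ) (β : ℝ) (f : EuclideanSpace ℝ (Fin n) → ℝ)
    (x : EuclideanSpace ℝ (Fin n)) : ℝ :=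
  (volume (ball (0 : EuclideanSpace ℝ (Fin n)) ‖x‖)).toReal ^ (β / n - 1) *
    ∫ y in closedBall (0 : EuclideanSpace ℝ (Fin n)) ‖x‖, f y

/-- The volume `ν_n` of the unit ball in `ℝⁿ`. -/
noncomputable def nu (n : ℕ) : ℝ :=
  (volume (ball (0 : EuclideanSpace ℝ (Fin n)) 1)).toReal

lemma powInt {c R : ℝ} (hc : 0 < c) (hR : 0 ≤ R) :
    ∫⁻ r in Ioc (0 : ℝ) R, ENNReal.ofReal (r ^ (c - 1)) = ENNReal.ofReal (R ^ c / c) := by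
  rw [← ofReal_integral_eq_lintegral_ofReal
    (intervalIntegral.intervalIntegrable_rpow' (by linarith)).1,
    ← intervalIntegral.integral_of_le hR, integral_rpow (Or.inl (by linarith))]
  · simp [Real.zero_rpow hc.ne']
  · filter_upwards [ae_restrict_mem measurableSet_Ioc] with y hy
    exact Real.rpow_nonneg hy.1.le _

instance (n : ℕ) : IsFiniteMeasure (sphereMeasure n) := by
  unfold sphereMeasure; infer_instance

lemma nu_pos (n : ℕ) : 0 < nu n :=
  ENNReal.toReal_pos (measure_ball_pos _ _ one_pos).ne' measure_ball_lt_top.ne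

lemma sphere_univ (n : ℕ) : sphereMeasure n univ = ENNReal.ofReal (n * nu n) := by
  unfold sphereMeasure nu
  rw [Measure.toSphere_apply_univ, ENNReal.ofReal_mul (by positivity),
    ENNReal.ofReal_toReal measure_ball_lt_top.ne]
  simp

lemma vol_ball (n : ℕ) (hn : 2 ≤ n) (R : ℝ) (hR : 0 ≤ R) :
    (volume (ball (0 : EuclideanSpace ℝ (Fin n)) R)).toReal = R ^ n * nu n := by
  have : Nonempty (Fin n) := ⟨⟨0, by omega⟩⟩
  rw [Measure.addHaar_ball _ _ hR, ENNReal.toReal_mul, ENNReal.toReal_ofReal (by positivity), nu]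
  simp

lemma polar (n : ℕ) (hn : 2 ≤ n) (g : EuclideanSpace ℝ (Fin n) → ℝ≥0∞) (hg : Measurable g) :
    ∫⁻ x, g x = ∫⁻ r in Ioi (0 : ℝ), (∫⁻ θ : sphere (0 : EuclideanSpace ℝ (Fin n)) 1,
        g (r • (θ : EuclideanSpace ℝ (Fin n))) ∂(sphereMeasure n)) *
      ENNReal.ofReal (r ^ ((n : ℝ) - 1)) := by
  have : Nonempty (Fin n) := ⟨⟨0, by omega⟩⟩
  let E := EuclideanSpace ℝ (Fin n)
  have hm := (volume : Measure E).measurePreserving_homeomorphUnitSphereProd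
  have h1 : ∫⁻ x, g x = ∫⁻ x : ({(0 : E)}ᶜ : Set E), g x ∂((volume : Measure E).comap (↑)) := by
    rw [lintegral_subtype_comap (measurableSet_singleton _).compl g, restrict_compl_singleton]
  have hmeas : Measurable (fun z : sphere (0 : E) 1 × Ioi (0 : ℝ) => g ((z.2 : ℝ) • (z.1 : E))) := by
    fun_prop
  have h2 := hm.lintegral_comp hmeas
  have h3 : ∀ x : ({(0 : E)}ᶜ : Set E), g ((((homeomorphUnitSphereProd E) x).2 : ℝ) •
      (((homeomorphUnitSphereProd E) x).1 : E)) = g x := by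
    intro x
    have : (x : E) ≠ 0 := x.2
    have h0 : ‖(x : E)‖ ≠ 0 := norm_ne_zero_iff.2 this
    simp [smul_smul, mul_inv_cancel₀ h0]
  rw [h1]
  simp_rw [h3] at h2
  rw [h2, lintegral_prod_symm' _ hmeas, Measure.volumeIoiPow,
    lintegral_withDensity_eq_lintegral_mul _ (by fun_prop) hmeas.lintegral_prod_left']
  simp only [Pi.mul_apply]
  have := lintegral_subtype_comap (μ := (volume : Measure ℝ)) (measurableSet_Ioi (a := (0 : ℝ)))
    (fun r => ENNReal.ofReal (r ^ (Module.finrank ℝ E - 1)) *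
      ∫⁻ θ : sphere (0 : E) 1, g (r • (θ : E)) ∂(volume : Measure E).toSphere)
  rw [this]
  refine setLIntegral_congr_fun measurableSet_Ioi ?_
  intro r hr
  simp only [sphereMeasure]
  rw [mul_comm]
  congr 2
  rw [← Real.rpow_natCast]
  congr 1
  simp only [E, finrank_euclideanSpace, Fintype.card_fin]
  rw [Nat.cast_sub (by omega)]; simp

lemma mixed_mono (n : ℕ) {p pt α : ℝ} (hp : 0 < p) (hpt : 0 < pt)
    {f g : EuclideanSpace ℝ (Fin n) → ℝ} (h : ∀ x, x ≠ 0 → |f x| ≤ |g x|) :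
    mixedNormW n p pt α f ≤ mixedNormW n p pt α g := by
  unfold mixedNormW
  refine ENNReal.rpow_le_rpow ?_ (by positivity)
  refine setLIntegral_mono' measurableSet_Ioi fun r hr => ?_
  refine mul_le_mul_left ?_ _
  refine ENNReal.rpow_le_rpow (lintegral_mono fun θ => ?_) (by positivity)
  refine ENNReal.rpow_le_rpow (ENNReal.ofReal_le_ofReal (h _ ?_)) hpt.le
  have : (r : ℝ) ≠ 0 := (mem_Ioi.1 hr).ne'
  have h2 : (θ : EuclideanSpace ℝ (Fin n)) ≠ 0 := ne_zero_of_mem_unit_sphere θ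
  simp [this, h2]

lemma mixed_radial (n : ℕ) {p pt α : ℝ} (hp : 0 < p) (hpt : 0 < pt) (g : ℝ → ℝ) :
    mixedNormW n p pt α (fun x => g ‖x‖) = ENNReal.ofReal (n * nu n) ^ (1 / pt) *
      (∫⁻ r in Ioi (0 : ℝ), ENNReal.ofReal |g r| ^ p *
        ENNReal.ofReal (r ^ ((n : ℝ) - 1 + α))) ^ (1 / p) := by
  unfold mixedNormW
  have : ∀ r ∈ Ioi (0 : ℝ), (∫⁻ θ : sphere (0 : EuclideanSpace ℝ (Fin n)) 1,
        ENNReal.ofReal |g ‖(r • (θ : EuclideanSpace ℝ (Fin n)))‖| ^ pt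
      ∂(sphereMeasure n)) ^ (p / pt) * ENNReal.ofReal (r ^ ((n : ℝ) - 1 + α)) =
      ENNReal.ofReal (n * nu n) ^ (p / pt) * (ENNReal.ofReal |g r| ^ p *
        ENNReal.ofReal (r ^ ((n : ℝ) - 1 + α))) := by
    intro r hr
    have hr' : 0 < r := hr
    simp only [norm_smul, norm_eq_of_mem_sphere, mul_one, Real.norm_eq_abs, abs_of_pos hr',
      lintegral_const, sphere_univ]
    rw [ENNReal.mul_rpow_of_nonneg _ _ (by positivity), ← ENNReal.rpow_mul,
      mul_div_cancel₀ _ hpt.ne']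
    ring
  rw [setLIntegral_congr_fun measurableSet_Ioi this, lintegral_const_mul' _ _
    (ENNReal.rpow_ne_top_of_nonneg (by positivity) ENNReal.ofReal_ne_top),
    ENNReal.mul_rpow_of_nonneg _ _ (by positivity), ← ENNReal.rpow_mul]
  congr 2
  field_simp

lemma mixed_pow (n : ℕ) {p pt α s R : ℝ} (hp : 0 < p) (hpt : 0 < pt) (hR : 0 ≤ R)
    (hs : 0 < n + α + s * p) :
    mixedNormW n p pt α (fun x => if ‖x‖ ≤ R then ‖x‖ ^ s else 0) =
      ENNReal.ofReal ((n * nu n) ^ (1 / pt) *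
        (R ^ (n + α + s * p) / (n + α + s * p)) ^ (1 / p)) := by
  have hnu := nu_pos n
  rw [mixed_radial n hp hpt (fun r => if r ≤ R then r ^ s else 0),
    ENNReal.ofReal_mul (p := (n * nu n) ^ (1 / pt)) (by positivity),
    ← ENNReal.ofReal_rpow_of_nonneg (by positivity) (by positivity),
    ← ENNReal.ofReal_rpow_of_nonneg (by positivity) (by positivity), ← powInt hs hR]
  congr 2
  rw [← Ioi_inter_Iic, inter_comm, ← Measure.restrict_restrict measurableSet_Iic,
    ← lintegral_indicator measurableSet_Iic]
  refine setLIntegral_congr_fun measurableSet_Ioi ?_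
  intro r hr
  have hr' : 0 < r := hr
  by_cases h : r ≤ R
  · simp only [h, if_true, indicator, mem_Iic]
    rw [abs_of_nonneg (by positivity), ENNReal.ofReal_rpow_of_nonneg (by positivity) hp.le,
      ← ENNReal.ofReal_mul (by positivity), ← Real.rpow_mul hr'.le, ← Real.rpow_add hr']
    congr 2; ring
  · simp [h, indicator, hp]

lemma ang_holder (n : ℕ) {pt : ℝ} (hpt : 1 < pt)
    (h : sphere (0 : EuclideanSpace ℝ (Fin n)) 1 → ℝ≥0∞) (hh : Measurable h) :
    ∫⁻ θ, h θ ∂(sphereMeasure n) ≤ (∫⁻ θ, h θ ^ pt ∂(sphereMeasure n)) ^ (1 / pt) *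
      ENNReal.ofReal ((n * nu n) ^ (1 - 1 / pt)) := by
  have hc := Real.HolderConjugate.conjExponent hpt
  have := ENNReal.lintegral_mul_le_Lp_mul_Lq (sphereMeasure n) hc
    hh.aemeasurable (aemeasurable_const (b := (1 : ℝ≥0∞)))
  have hnu := nu_pos n
  have e : 1 / Real.conjExponent pt = 1 - 1 / pt := by
    unfold Real.conjExponent
    have : pt - 1 ≠ 0 := by linarith
    field_simp
  have e2 : 0 ≤ 1 - 1 / pt := by
    rw [← e]; exact (one_div_pos.2 hc.symm.pos).le
  rw [e] at this
  rw [← ENNReal.ofReal_rpow_of_nonneg (by positivity) e2, ← sphere_univ]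
  simpa using this

lemma hardy_bound (n : ℕ) (hn : 2 ≤ n) {p pt α R : ℝ} (hp : 1 < p) (hpt : 1 < pt) (hR : 0 ≤ R)
    (hα : α < n * (p - 1)) (f : EuclideanSpace ℝ (Fin n) → ℝ) (hf : Measurable f) :
    ∫⁻ y in closedBall (0 : EuclideanSpace ℝ (Fin n)) R, ENNReal.ofReal |f y| ≤
      ENNReal.ofReal ((n * nu n) ^ (1 - 1 / pt) *
        (R ^ (n - α / (p - 1)) / (n - α / (p - 1))) ^ (1 - 1 / p)) * mixedNormW n p pt α f := by
  have hnu := nu_pos n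
  have hp1 : 0 < p - 1 := by linarith
  have hp0 : 0 < p := by linarith
  have hpt0 : 0 < pt := by linarith
  have ha : 0 < n - α / (p - 1) := by
    rw [sub_pos, div_lt_iff₀ hp1]; exact hα
  have hc := Real.HolderConjugate.conjExponent hp
  have e : 1 / Real.conjExponent p = 1 - 1 / p := by
    unfold Real.conjExponent
    field_simp
  have e2 : 0 ≤ 1 - 1 / p := by
    rw [← e]; exact (one_div_pos.2 hc.symm.pos).le
  set F : ℝ → ℝ≥0∞ := fun r => ∫⁻ θ : sphere (0 : EuclideanSpace ℝ (Fin n)) 1,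
        ENNReal.ofReal |f (r • (θ : EuclideanSpace ℝ (Fin n)))| ^ pt ∂(sphereMeasure n) with hF
  have hFm : Measurable F := by
    apply Measurable.lintegral_prod_right'
      (f := fun z : ℝ × sphere (0 : EuclideanSpace ℝ (Fin n)) 1 =>
        ENNReal.ofReal |f (z.1 • (z.2 : EuclideanSpace ℝ (Fin n)))| ^ pt)
    have : Measurable (fun z : ℝ × sphere (0 : EuclideanSpace ℝ (Fin n)) 1 =>
        f (z.1 • (z.2 : EuclideanSpace ℝ (Fin n)))) := by fun_prop
    exact (ENNReal.measurable_ofReal.comp this.abs).pow_const _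
  have hfm : Measurable fun y => ENNReal.ofReal |f y| := ENNReal.measurable_ofReal.comp hf.abs
  calc ∫⁻ y in closedBall (0 : EuclideanSpace ℝ (Fin n)) R, ENNReal.ofReal |f y|
      = ∫⁻ y, (closedBall (0 : EuclideanSpace ℝ (Fin n)) R).indicator
          (fun y => ENNReal.ofReal |f y|) y := by
        rw [lintegral_indicator measurableSet_closedBall]
    _ = ∫⁻ r in Ioi (0 : ℝ), (Iic R).indicator (fun r =>
          (∫⁻ θ : sphere (0 : EuclideanSpace ℝ (Fin n)) 1,
            ENNReal.ofReal |f (r • (θ : EuclideanSpace ℝ (Fin n)))| ∂(sphereMeasure n)) *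
          ENNReal.ofReal (r ^ ((n : ℝ) - 1))) r := by
        rw [polar n hn _ (hfm.indicator measurableSet_closedBall)]
        refine setLIntegral_congr_fun measurableSet_Ioi fun r hr => ?_
        have hr' : 0 < r := hr
        by_cases h : r ≤ R
        · simp [indicator, h, norm_smul, abs_of_pos hr']
        · simp [indicator, h, norm_smul, abs_of_pos hr']
    _ = ∫⁻ r in Ioc (0 : ℝ) R, (∫⁻ θ : sphere (0 : EuclideanSpace ℝ (Fin n)) 1,
            ENNReal.ofReal |f (r • (θ : EuclideanSpace ℝ (Fin n)))| ∂(sphereMeasure n)) *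
          ENNReal.ofReal (r ^ ((n : ℝ) - 1)) := by
        rw [lintegral_indicator measurableSet_Iic, Measure.restrict_restrict measurableSet_Iic,
          inter_comm, Ioi_inter_Iic]
    _ ≤ ∫⁻ r in Ioc (0 : ℝ) R, ENNReal.ofReal ((n * nu n) ^ (1 - 1 / pt)) *
          (((fun r => F r ^ (1 / pt) * ENNReal.ofReal (r ^ ((n - 1 + α) / p))) *
          (fun r => ENNReal.ofReal (r ^ ((n - α / (p - 1) - 1) * (1 - 1 / p))))) r) := by
        refine setLIntegral_mono' measurableSet_Ioc fun r hr => ?_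
        have hr' : 0 < r := hr.1
        have hm : Measurable fun θ : sphere (0 : EuclideanSpace ℝ (Fin n)) 1 =>
            ENNReal.ofReal |f (r • (θ : EuclideanSpace ℝ (Fin n)))| := by fun_prop
        refine (mul_le_mul_left (ang_holder n hpt _ hm) _).trans (le_of_eq ?_)
        simp only [Pi.mul_apply]
        have : ENNReal.ofReal (r ^ ((n : ℝ) - 1)) = ENNReal.ofReal (r ^ ((n - 1 + α) / p)) *
            ENNReal.ofReal (r ^ ((n - α / (p - 1) - 1) * (1 - 1 / p))) := by
          rw [← ENNReal.ofReal_mul (by positivity), ← Real.rpow_add hr']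
          congr 2
          field_simp
          ring
        rw [this]
        ring
    _ = ENNReal.ofReal ((n * nu n) ^ (1 - 1 / pt)) * ∫⁻ r in Ioc (0 : ℝ) R, 
          (((fun r => F r ^ (1 / pt) * ENNReal.ofReal (r ^ ((n - 1 + α) / p))) *
          (fun r => ENNReal.ofReal (r ^ ((n - α / (p - 1) - 1) * (1 - 1 / p))))) r) := by
        rw [lintegral_const_mul' _ _ ENNReal.ofReal_ne_top]
    _ ≤ ENNReal.ofReal ((n * nu n) ^ (1 - 1 / pt)) * (mixedNormW n p pt α f *
          ENNReal.ofReal ((R ^ (n - α / (p - 1)) / (n - α / (p - 1))) ^ (1 - 1 / p))) := by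
        refine mul_le_mul_right ?_ _
        refine (ENNReal.lintegral_mul_le_Lp_mul_Lq _ hc ?_ ?_).trans ?_
        · fun_prop
        · fun_prop
        refine mul_le_mul' ?_ ?_
        · unfold mixedNormW
          refine ENNReal.rpow_le_rpow ?_ (by positivity)
          refine (lintegral_mono_set Ioc_subset_Ioi_self).trans (le_of_eq ?_)
          refine setLIntegral_congr_fun measurableSet_Ioi fun r hr => ?_
          have hr' : 0 < r := hr
          beta_reduce
          rw [ENNReal.mul_rpow_of_nonneg _ _ hp0.le, ← ENNReal.rpow_mul,
            ENNReal.ofReal_rpow_of_nonneg (by positivity) hp0.le, ← Real.rpow_mul hr'.le,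
            div_mul_cancel₀ _ hp0.ne', one_div_mul_eq_div]
        · rw [e, ← ENNReal.ofReal_rpow_of_nonneg (by positivity) e2, ← powInt ha hR]
          refine ENNReal.rpow_le_rpow (le_of_eq ?_) e2
          refine setLIntegral_congr_fun measurableSet_Ioc fun r hr => ?_
          have hr' : 0 < r := hr.1
          beta_reduce
          rw [ENNReal.ofReal_rpow_of_nonneg (by positivity) hc.symm.pos.le, ← Real.rpow_mul hr'.le,
            ← e, mul_assoc, one_div_mul_cancel hc.symm.pos.ne', mul_one]
    _ = _ := by
        rw [ENNReal.ofReal_mul (by positivity)]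
        ring

lemma hardy_pointwise (n : ℕ) (hn : 2 ≤ n) {β p q pt α₁ α₂ : ℝ}
    (hp : 1 < p) (hpt : 1 < pt) (hα₁ : α₁ < n * (p - 1)) 
    (hscale : (α₂ + n) / q = (α₁ + n) / p - β)
    (f : EuclideanSpace ℝ (Fin n) → ℝ) (hf : Measurable f) (hN : mixedNormW n p pt α₁ f < ⊤)
    (x : EuclideanSpace ℝ (Fin n)) (hx : x ≠ 0) :
    |fracHardy n β f x| ≤ ((n * nu n) ^ (1 - 1 / pt) * nu n ^ (β / n - 1) *
            (1 / (n - α₁ / (p - 1))) ^ (1 - 1 / p)) * (mixedNormW n p pt α₁ f).toReal *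
          ‖x‖ ^ (-((α₂ + n) / q)) := by
  have hnu := nu_pos n
  have hx' : 0 < ‖x‖ := norm_pos_iff.2 hx
  have hp1 : 0 < p - 1 := by linarith
  have ha : 0 < n - α₁ / (p - 1) := by
    rw [sub_pos, div_lt_iff₀ hp1]; exact hα₁
  have hn0 : (n : ℝ) ≠ 0 := by positivity
  have hb := hardy_bound n hn hp hpt hx'.le hα₁ f hf
  have h1 : |∫ y in closedBall (0 : EuclideanSpace ℝ (Fin n)) ‖x‖, f y| ≤
      ((n * nu n) ^ (1 - 1 / pt) *
        (‖x‖ ^ (n - α₁ / (p - 1)) / (n - α₁ / (p - 1))) ^ (1 - 1 / p)) *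
        (mixedNormW n p pt α₁ f).toReal := by
    have h2 := (enorm_integral_le_lintegral_enorm (μ := volume.restrict
      (closedBall (0 : EuclideanSpace ℝ (Fin n)) ‖x‖)) f)
    simp_rw [Real.enorm_eq_ofReal_abs] at h2
    have h3 := ENNReal.toReal_mono (ENNReal.mul_ne_top ENNReal.ofReal_ne_top hN.ne) (h2.trans hb)
    rwa [ENNReal.toReal_mul, ENNReal.toReal_ofReal (abs_nonneg _),
      ENNReal.toReal_ofReal (by positivity)] at h3
  unfold fracHardy
  rw [vol_ball n hn _ hx'.le, abs_mul, abs_of_nonneg (by positivity)]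
  refine (mul_le_mul_of_nonneg_left h1 (by positivity)).trans (le_of_eq ?_)
  rw [Real.mul_rpow (by positivity) hnu.le, div_eq_mul_one_div (‖x‖ ^ _),
    Real.mul_rpow (x := ‖x‖ ^ _) (by positivity) (by positivity), ← Real.rpow_natCast,
    ← Real.rpow_mul hx'.le,
    ← Real.rpow_mul hx'.le]
  have : ‖x‖ ^ (-((α₂ + n) / q)) = ‖x‖ ^ ((n : ℝ) * (β / n - 1)) *
      ‖x‖ ^ ((n - α₁ / (p - 1)) * (1 - 1 / p)) := by
    rw [← Real.rpow_add hx', hscale]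
    congr 1
    field_simp
    ring
  rw [this]
  ring

theorem upper (n : ℕ) (hn : 2 ≤ n) (β p q pt₁ pt₂ α₁ α₂ : ℝ)
    (hp : 1 < p) (hpt₁ : 1 < pt₁) (hpt₂ : 1 < pt₂) (hq : 1 ≤ q)
    (hα₁ : α₁ < n * (p - 1)) (hα₂ : 0 < n + α₂)
    (hscale : (α₂ + n) / q = (α₁ + n) / p - β)
    (f : EuclideanSpace ℝ (Fin n) → ℝ) (hf : Measurable f) (hN : mixedNormW n p pt₁ α₁ f < ⊤) :
      weakMixedNormW n q pt₂ α₂ (fracHardy n β f)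
        ≤ ENNReal.ofReal ((n * nu n) ^ ((1 - 1 / pt₁) + 1 / pt₂) * nu n ^ (β / n - 1) *
            (1 / (n - α₁ / (p - 1))) ^ (1 - 1 / p) * (1 / (n + α₂)) ^ (1 / q)) *
          mixedNormW n p pt₁ α₁ f := by
  have hnu := nu_pos n
  have hq0 : 0 < q := by linarith
  have hp1 : 0 < p - 1 := by linarith
  have ha : 0 < n - α₁ / (p - 1) := by
    rw [sub_pos, div_lt_iff₀ hp1]; exact hα₁
  have hγ : 0 < (α₂ + n) / q := div_pos (by linarith) hq0
  set γ := (α₂ + n) / q with hγd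
  set A := ((n * nu n) ^ (1 - 1 / pt₁) * nu n ^ (β / n - 1) *
            (1 / (n - α₁ / (p - 1))) ^ (1 - 1 / p)) with hA
  have hA0 : 0 ≤ A := by positivity
  set N := (mixedNormW n p pt₁ α₁ f).toReal with hNd
  have hN0 : 0 ≤ N := ENNReal.toReal_nonneg
  unfold weakMixedNormW
  refine iSup₂_le fun lam hlam => ?_
  have hm : mixedNormW n q pt₂ α₂ (fun x => if lam < |fracHardy n β f x| then 1 else 0) ≤
      mixedNormW n q pt₂ α₂
        (fun x => if ‖x‖ ≤ (A * N / lam) ^ (1 / γ) then ‖x‖ ^ (0 : ℝ) else 0) := by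
    refine mixed_mono n hq0 (by linarith) fun x hx => ?_
    by_cases h : lam < |fracHardy n β f x|
    · have hx' : 0 < ‖x‖ := norm_pos_iff.2 hx
      have h1 := h.trans_le (hardy_pointwise n hn hp hpt₁ hα₁ hscale f hf hN x hx)
      have h2 : ‖x‖ ≤ (A * N / lam) ^ (1 / γ) := by
        rw [one_div, Real.le_rpow_inv_iff_of_pos hx'.le (by positivity) hγ, le_div_iff₀ hlam]
        rw [Real.rpow_neg hx'.le, ← div_eq_mul_inv, lt_div_iff₀ (by positivity)] at h1
        linarith
      rw [if_pos h, if_pos h2]; simp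
    · simp [h]
  refine (mul_le_mul_right hm _).trans (le_of_eq ?_)
  rw [mixed_pow n hq0 (by linarith) (by positivity) (by simpa using hα₂),
    ← ENNReal.ofReal_toReal hN.ne, ← hNd, ← ENNReal.ofReal_mul hlam.le,
    ← ENNReal.ofReal_mul (by positivity)]
  congr 1
  rw [zero_mul, add_zero, ← Real.rpow_mul (by positivity), div_eq_mul_one_div (_ ^ _),
    Real.mul_rpow (x := (A * N / lam) ^ _) (by positivity) (by positivity),
    ← Real.rpow_mul (by positivity),
    show 1 / γ * (n + α₂) * (1 / q) = 1 by rw [hγd]; field_simp; rw [add_comm (n : ℝ), div_self (by linarith)],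
    Real.rpow_one, Real.rpow_add (by positivity), hA]
  field_simp

lemma mixed_one (n : ℕ) (hn : 2 ≤ n) (f : EuclideanSpace ℝ (Fin n) → ℝ) (hf : Measurable f) :
    mixedNormW n 1 1 0 f = ∫⁻ x, ENNReal.ofReal |f x| := by
  rw [polar n hn _ (by fun_prop)]
  simp [mixedNormW]

lemma meas_pow (n : ℕ) (a R : ℝ) : Measurable
    (fun x : EuclideanSpace ℝ (Fin n) => if ‖x‖ ≤ R then ‖x‖ ^ a else 0) :=
  Measurable.ite (measurableSet_le measurable_norm measurable_const)
    (measurable_norm.pow_const _) measurable_const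

lemma int_pow (n : ℕ) (hn : 2 ≤ n) {a R : ℝ} (ha : 0 < n - a) (hR : 0 ≤ R) (hR1 : R ≤ 1) :
    ∫ y in closedBall (0 : EuclideanSpace ℝ (Fin n)) R, (if ‖y‖ ≤ 1 then ‖y‖ ^ (-a) else 0) =
      n * nu n * (R ^ (n - a) / (n - a)) := by
  have hnu := nu_pos n
  have h0 : ∀ y : EuclideanSpace ℝ (Fin n), 0 ≤ (if ‖y‖ ≤ R then ‖y‖ ^ (-a) else 0) := by
    intro y; split_ifs <;> positivity
  have h1 : ∫ y in closedBall (0 : EuclideanSpace ℝ (Fin n)) R,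
      (if ‖y‖ ≤ 1 then ‖y‖ ^ (-a) else 0) =
      ∫ y : EuclideanSpace ℝ (Fin n), (if ‖y‖ ≤ R then ‖y‖ ^ (-a) else 0) := by
    rw [← integral_indicator measurableSet_closedBall]
    congr 1
    ext y
    by_cases h : ‖y‖ ≤ R
    · simp [indicator, h, h.trans hR1]
    · simp [indicator, h]
  have h2 := mixed_one n hn _ (meas_pow n (-a) R)
  rw [mixed_pow n one_pos one_pos hR (by linarith)] at h2
  simp_rw [abs_of_nonneg (h0 _)] at h2
  rw [h1, integral_eq_lintegral_of_nonneg_ae (Filter.Eventually.of_forall h0)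
    (meas_pow n (-a) R).aestronglyMeasurable, ← h2, ENNReal.toReal_ofReal]
  · simp [sub_eq_add_neg]
  · have : 0 < n + 0 + -a * 1 := by linarith
    positivity

theorem lower (n : ℕ) (hn : 2 ≤ n) (β p q pt₁ pt₂ α₁ α₂ : ℝ)
    (hp : 1 < p) (hpt₁ : 1 < pt₁) (hpt₂ : 1 < pt₂) (hq : 1 ≤ q)
    (hα₁ : α₁ < n * (p - 1)) (hα₂ : 0 < n + α₂) (hβα : β ≤ α₁ / (p - 1)) (C : ℝ≥0∞)
    (H : ∀ f : EuclideanSpace ℝ (Fin n) → ℝ, Measurable f → mixedNormW n p pt₁ α₁ f < ⊤ →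
        weakMixedNormW n q pt₂ α₂ (fracHardy n β f) ≤ C * mixedNormW n p pt₁ α₁ f) :
      ENNReal.ofReal ((n * nu n) ^ ((1 - 1 / pt₁) + 1 / pt₂) * nu n ^ (β / n - 1) *
          (1 / (n - α₁ / (p - 1))) ^ (1 - 1 / p) * (1 / (n + α₂)) ^ (1 / q)) ≤ C := by
  have hnu := nu_pos n
  have hq0 : 0 < q := by linarith
  have hp0 : 0 < p := by linarith
  have hp1 : 0 < p - 1 := by linarith
  have ha : 0 < n - α₁ / (p - 1) := by
    rw [sub_pos, div_lt_iff₀ hp1]; exact hα₁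
  have hn0 : (0 : ℝ) < n := by positivity
  have hexp : n + α₁ + -(α₁ / (p - 1)) * p = n - α₁ / (p - 1) := by field_simp; ring
  set a := α₁ / (p - 1) with had
  have hN := mixed_pow n (p := p) (pt := pt₁) (α := α₁) (s := -a) (R := 1) hp0 (by linarith)
    zero_le_one (by rw [hexp]; exact ha)
  rw [hexp, Real.one_rpow] at hN
  set f : EuclideanSpace ℝ (Fin n) → ℝ := fun x => if ‖x‖ ≤ 1 then ‖x‖ ^ (-a) else 0 with hfd
  set N := (n * nu n) ^ (1 / pt₁) * (1 / (n - a)) ^ (1 / p) with hNd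
  have hNpos : 0 < N := by positivity
  have h1 := H f (meas_pow n _ _) (by rw [hN]; exact ENNReal.ofReal_lt_top)
  rw [hN] at h1
  set M := nu n ^ (β / n - 1) * (n * nu n) * (1 / (n - a)) with hM
  have hMpos : 0 < M := by positivity
  set B := (n * nu n) ^ (1 / pt₂) * (1 / (n + α₂)) ^ (1 / q) with hB
  have hBpos : 0 < B := by positivity
  have hpt : ∀ x : EuclideanSpace ℝ (Fin n), x ≠ 0 → ‖x‖ ≤ 1 → M ≤ |fracHardy n β f x| := by
    intro x hx hx1
    have hx' : 0 < ‖x‖ := norm_pos_iff.2 hx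
    unfold fracHardy
    rw [hfd, int_pow n hn ha hx'.le hx1, vol_ball n hn _ hx'.le, abs_of_nonneg (by positivity),
      Real.mul_rpow (by positivity) hnu.le, ← Real.rpow_natCast, ← Real.rpow_mul hx'.le]
    have e : ‖x‖ ^ ((n : ℝ) * (β / n - 1)) * nu n ^ (β / n - 1) *
        (n * nu n * (‖x‖ ^ (n - a) / (n - a))) = M * ‖x‖ ^ (β - a) := by
      have : ‖x‖ ^ (β - a) = ‖x‖ ^ ((n : ℝ) * (β / n - 1)) * ‖x‖ ^ (n - a) := by
        rw [← Real.rpow_add hx']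
        congr 1
        field_simp
        ring
      rw [this, hM]
      ring
    rw [e]
    exact le_mul_of_one_le_right hMpos.le
      (Real.one_le_rpow_of_pos_of_le_one_of_nonpos hx' hx1 (by linarith))
  have hI := mixed_pow n (p := q) (pt := pt₂) (α := α₂) (s := 0) (R := 1) hq0 (by linarith)
    zero_le_one (by simpa using hα₂)
  rw [zero_mul, add_zero, Real.one_rpow, ← hB] at hI
  have h2 : ∀ lam : ℝ, 0 < lam → lam < M →
      ENNReal.ofReal lam * ENNReal.ofReal B ≤ C * ENNReal.ofReal N := by
    intro lam h0 hl
    refine le_trans ?_ h1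
    unfold weakMixedNormW
    refine le_trans ?_ (le_iSup₂ lam h0)
    refine mul_le_mul_right ?_ _
    rw [← hI]
    refine mixed_mono n hq0 (by linarith) fun x hx => ?_
    by_cases h : ‖x‖ ≤ 1
    · have := hl.trans_le (hpt x hx h)
      rw [if_pos h, if_pos this]; simp
    · simp [h]
  have hB0 : ENNReal.ofReal B ≠ 0 := (ENNReal.ofReal_pos.2 hBpos).ne'
  have hN0 : ENNReal.ofReal N ≠ 0 := (ENNReal.ofReal_pos.2 hNpos).ne'
  have h3 : ENNReal.ofReal M ≤ C * ENNReal.ofReal N / ENNReal.ofReal B := by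
    refine le_of_forall_lt_imp_le_of_dense fun c hc => ?_
    rcases eq_or_ne c 0 with rfl | hc0
    · exact zero_le
    have hct : c ≠ ⊤ := (hc.trans ENNReal.ofReal_lt_top).ne
    rw [ENNReal.le_div_iff_mul_le (Or.inl hB0) (Or.inl ENNReal.ofReal_ne_top)]
    have := h2 c.toReal (ENNReal.toReal_pos hc0 hct) ((ENNReal.lt_ofReal_iff_toReal_lt hct).1 hc)
    rwa [ENNReal.ofReal_toReal hct] at this
  rw [ENNReal.le_div_iff_mul_le (Or.inl hB0) (Or.inl ENNReal.ofReal_ne_top),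
    ← ENNReal.div_le_iff hN0 ENNReal.ofReal_ne_top, ← ENNReal.ofReal_mul hMpos.le,
    ← ENNReal.ofReal_div_of_pos hNpos] at h3
  refine le_trans (le_of_eq ?_) h3
  congr 1
  rw [eq_div_iff hNpos.ne', hNd, hM, hB, Real.rpow_add (by positivity),
    Real.rpow_sub (by positivity) 1 (1 / pt₁), Real.rpow_sub (by positivity) 1 (1 / p),
    Real.rpow_one, Real.rpow_one]
  have u1 : (n * nu n) ^ (1 / pt₁) ≠ 0 := by positivity
  have u2 : (1 / (n - a)) ^ (1 / p) ≠ 0 := by positivity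
  generalize (n * nu n) ^ (1 / pt₁) = U at *
  generalize (1 / (n - a)) ^ (1 / p) = V at *
  generalize (1 / (n + α₂)) ^ (1 / q) = W at *
  generalize 1 / (n - a) = Y at *
  field_simp


/-- The fractional Hardy operator maps `L^p_{rad}L^{p̃₁}_{ang}(ℝⁿ, r^{α₁})` to the weak space
`𝓦L^q_{rad}L^{p̃₂}_{ang}(ℝⁿ, r^{α₂})` with operator norm exactly
`ω_n^{1/p̃₁' + 1/p̃₂} ν_n^{β/n − 1} (1/(n − α₁/(p−1)))^{1/p'} (1/(n+α₂))^{1/q}`. -/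
theorem fracHardy_mixed_weak_norm (n : ℕ) (hn : 2 ≤ n) (β p q pt₁ pt₂ α₁ α₂ : ℝ)
    (hp : 1 < p) (hpt₁ : 1 < pt₁) (hpt₂ : 1 < pt₂) (hq : 1 ≤ q)
    (hα₁ : α₁ < n * (p - 1)) (hα₂ : 0 < n + α₂)
    (hβ₀ : 0 < β) (hβα : β ≤ α₁ / (p - 1))
    (hscale : (α₂ + n) / q = (α₁ + n) / p - β) :
    (∀ f : EuclideanSpace ℝ (Fin n) → ℝ, Measurable f → mixedNormW n p pt₁ α₁ f < ⊤ →
      weakMixedNormW n q pt₂ α₂ (fracHardy n β f)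
        ≤ ENNReal.ofReal ((n * nu n) ^ ((1 - 1 / pt₁) + 1 / pt₂) * nu n ^ (β / n - 1) *
            (1 / (n - α₁ / (p - 1))) ^ (1 - 1 / p) * (1 / (n + α₂)) ^ (1 / q)) *
          mixedNormW n p pt₁ α₁ f) ∧
    (∀ C : ℝ≥0∞,
      (∀ f : EuclideanSpace ℝ (Fin n) → ℝ, Measurable f → mixedNormW n p pt₁ α₁ f < ⊤ →
        weakMixedNormW n q pt₂ α₂ (fracHardy n β f) ≤ C * mixedNormW n p pt₁ α₁ f) →
      ENNReal.ofReal ((n * nu n) ^ ((1 - 1 / pt₁) + 1 / pt₂) * nu n ^ (β / n - 1) *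
          (1 / (n - α₁ / (p - 1))) ^ (1 - 1 / p) * (1 / (n + α₂)) ^ (1 / q)) ≤ C) := by

  exact ⟨fun f hf hN => upper n hn β p q pt₁ pt₂ α₁ α₂ hp hpt₁ hpt₂ hq hα₁ hα₂ hscale f hf hN,
    fun C H => lower n hn β p q pt₁ pt₂ α₁ α₂ hp hpt₁ hpt₂ hq hα₁ hα₂ hβα C H⟩
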